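/- Let k be a field and S = k[x,y,z,t]. Let J ⊆ S be an ideal generated by a set of monomials of degree 2 whose Hilbert function satisfies h(0) = 1, h(1) = 4, h(2) = 3, and h(m) = 1 for all m ≥ 3 (where h(m) = dim_k (S/J)_m). Then there is a permutation of the variables {x, y, z, t} carrying J to the ideal (y², z², t², xy, xz, xt, zt). -/

import Mathlib

open MvPolynomial

/-- The Hilbert function of `S/J`: the `k`-dimension of the degree-`m`
homogeneous component of `S/J`. -/
noncomputable def hilbFn (k : Type*) [Field k] (n : ℕ)
    (J : Ideal (MvPolynomial (Fin n) k)) (m : ℕ) : ℕ :=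
  Module.finrank k
    ((MvPolynomial.homogeneousSubmodule (Fin n) k m).map
      (Ideal.Quotient.mkₐ k J).toLinearMap)

/-- The exponents of degree `m` lying above no element of `s`. -/
def standardExponents {σ : Type*} (s : Set (σ →₀ ℕ)) (m : ℕ) : Set (σ →₀ ℕ) :=
  {d | d.degree = m ∧ ∀ e ∈ s, ¬ e ≤ d}

/-- The Hilbert function of a monomial ideal counts standard monomials. -/
theorem hilbFn_span_monomial (k : Type*) [Field k] (n : ℕ) (s : Set (Fin n →₀ ℕ)) (m : ℕ) :
    hilbFn k n (Ideal.span ((fun e => monomial e (1 : k)) '' s)) m =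
      (standardExponents s m).ncard := by
  set J := Ideal.span ((fun e => monomial e (1 : k)) '' s) with hJ
  set f := (Ideal.Quotient.mkₐ k J).toLinearMap
  have hker : ∀ p, f p = 0 ↔ p ∈ J := fun p => Ideal.Quotient.eq_zero_iff_mem
  have hmap : (homogeneousSubmodule (Fin n) k m).map f =
      (restrictSupport k (standardExponents s m)).map f := by
    apply le_antisymm
    · rintro _ ⟨p, hp, rfl⟩
      rw [p.as_sum, map_sum]
      refine Submodule.sum_mem _ fun d hd => ?_
      by_cases h : ∃ e ∈ s, e ≤ d
      · have : f (monomial d (p.coeff d)) = 0 := by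
          rw [hker, hJ, mem_ideal_span_monomial_image]
          intro x hx
          rw [Finset.mem_singleton.mp (support_monomial_subset hx)]
          exact h
        rw [this]
        exact Submodule.zero_mem _
      · push Not at h
        refine Submodule.mem_map_of_mem ?_
        rw [mem_restrictSupport_iff]
        intro x hx
        rw [Finset.mem_singleton.mp (support_monomial_subset hx)]
        refine ⟨?_, h⟩
        rw [Finsupp.degree_eq_weight_one]
        exact hp (mem_support_iff.mp hd)
    · refine Submodule.map_mono fun p hp => ?_
      rw [mem_restrictSupport_iff] at hp
      intro d hd
      exact (Finsupp.degree_eq_weight_one (R := ℕ) ▸ (hp (mem_support_iff.mpr hd)).1 :)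
  have hinj : Function.Injective
      (f.comp (restrictSupport k (standardExponents s m)).subtype) := by
    rw [← LinearMap.ker_eq_bot, LinearMap.ker_eq_bot']
    rintro ⟨p, hp⟩ h
    have hpJ : p ∈ J := (hker p).mp h
    rw [hJ, mem_ideal_span_monomial_image] at hpJ
    rw [mem_restrictSupport_iff] at hp
    have : p.support = ∅ := by
      refine Finset.eq_empty_of_forall_notMem fun d hd => ?_
      obtain ⟨e, he, hle⟩ := hpJ d hd
      exact (hp hd).2 e he hle
    exact Subtype.ext (support_eq_empty.mp this)
  have hrange : (f.comp (restrictSupport k (standardExponents s m)).subtype).range =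
      (restrictSupport k (standardExponents s m)).map f := by
    rw [LinearMap.range_comp, Submodule.range_subtype]
  rw [hilbFn, hmap, ← hrange, LinearMap.finrank_range_of_inj hinj,
    Module.finrank_eq_nat_card_basis (basisRestrictSupport k _), Nat.card_coe_set_eq]

/-- The exponents of the monomials `X i * X j` with `P i j`. -/
def quadraticExponents {σ : Type*} (P : σ → σ → Prop) : Set (σ →₀ ℕ) :=
  {e | ∃ i j, P i j ∧ e = Finsupp.single i 1 + Finsupp.single j 1}

theorem mem_standardExponents_quadratic {σ : Type*} {P : σ → σ → Prop} {m : ℕ} {d : σ →₀ ℕ} :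
    d ∈ standardExponents (quadraticExponents P) m ↔ d.degree = m ∧
      ∀ i j, P i j → ¬ Finsupp.single i 1 + Finsupp.single j 1 ≤ d := by
  constructor
  · rintro ⟨h, h'⟩
    exact ⟨h, fun i j hij => h' _ ⟨i, j, hij, rfl⟩⟩
  · rintro ⟨h, h'⟩
    refine ⟨h, ?_⟩
    rintro _ ⟨i, j, hij, rfl⟩
    exact h' i j hij

theorem eq_or_eq_of_single_add_single_le {σ : Type*} {a b i j : σ} {p q : ℕ}
    (h : Finsupp.single i 1 + Finsupp.single j 1 ≤ Finsupp.single a p + Finsupp.single b q) :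
    (i = a ∨ i = b) ∧ (j = a ∨ j = b) := by
  classical
  have hi := h i
  have hj := h j
  simp only [Finsupp.add_apply, Finsupp.single_apply] at hi hj
  constructor
  · by_contra! hne
    simp [hne.1.symm, hne.2.symm] at hi
  · by_contra! hne
    simp [hne.1.symm, hne.2.symm] at hj

theorem single_mem_standardExponents {σ : Type*} {P : σ → σ → Prop} {i : σ} (hi : ¬ P i i)
    (m : ℕ) : Finsupp.single i m ∈ standardExponents (quadraticExponents P) m := by
  refine mem_standardExponents_quadratic.mpr ⟨by simp, fun a b hab hle => hi ?_⟩
  have := eq_or_eq_of_single_add_single_le (a := i) (b := i) (q := 0) (by simpa using hle)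
  simp only [or_self] at this
  rwa [this.1, this.2] at hab

theorem single_add_single_mem_standardExponents {σ : Type*} {P : σ → σ → Prop}
    (hP : ∀ i j, P i j → P j i) {i j : σ} (hij : i ≠ j) (hi : ¬ P i i) (h : ¬ P i j) (m : ℕ) :
    Finsupp.single i m + Finsupp.single j 1 ∈
      standardExponents (quadraticExponents P) (m + 1) := by
  refine mem_standardExponents_quadratic.mpr ⟨by simp, fun a b hab hle => ?_⟩
  obtain ⟨ha | ha, hb | hb⟩ := eq_or_eq_of_single_add_single_le hle <;> subst a <;> subst b
  · exact hi hab
  · exact h hab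
  · exact h (hP _ _ hab)
  · have := hle j
    simp [hij] at this

theorem Finsupp.exists_eq_single_add_single_of_degree_eq_two {σ : Type*} {d : σ →₀ ℕ}
    (h : d.degree = 2) : ∃ i j, d = Finsupp.single i 1 + Finsupp.single j 1 := by
  have key : ∀ {e : σ →₀ ℕ} {n : ℕ}, e.degree = n + 1 →
      ∃ i, ∃ e' : σ →₀ ℕ, e = Finsupp.single i 1 + e' ∧ e'.degree = n := by
    intro e n he
    have hne : e ≠ 0 := by rintro rfl; simp at he
    obtain ⟨i, hi⟩ := Finsupp.ne_iff.mp hne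
    have hle : Finsupp.single i 1 ≤ e := by
      rw [Finsupp.single_le_iff]
      exact Nat.one_le_iff_ne_zero.mpr hi
    obtain ⟨e', rfl⟩ := exists_add_of_le hle
    refine ⟨i, e', rfl, ?_⟩
    rw [map_add, Finsupp.degree_single] at he
    omega
  obtain ⟨i, e, rfl, he⟩ := key h
  obtain ⟨j, e', rfl, he'⟩ := key he
  rw [Finsupp.degree_eq_zero_iff] at he'
  exact ⟨i, j, by rw [he', add_zero]⟩

theorem ncard_standardExponents_quadratic_two {P : Fin 4 → Fin 4 → Prop} [DecidableRel P]
    (hP : ∀ i j, P i j → P j i) :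
    (standardExponents (quadraticExponents P) 2).ncard =
      (Finset.univ.filter fun p : Fin 4 × Fin 4 => p.1 ≤ p.2 ∧ ¬ P p.1 p.2).card := by
  set A := Finset.univ.filter fun p : Fin 4 × Fin 4 => p.1 ≤ p.2 ∧ ¬ P p.1 p.2 with hA
  let g : Fin 4 × Fin 4 → (Fin 4 →₀ ℕ) := fun p => Finsupp.single p.1 1 + Finsupp.single p.2 1
  have himage : standardExponents (quadraticExponents P) 2 = g '' A := by
    ext d
    rw [mem_standardExponents_quadratic]
    constructor
    · rintro ⟨hd, hs⟩
      obtain ⟨i, j, rfl⟩ := Finsupp.exists_eq_single_add_single_of_degree_eq_two hd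
      rcases le_total i j with h | h
      · exact ⟨(i, j), by simpa [hA, h] using fun hij => hs i j hij le_rfl, rfl⟩
      · exact ⟨(j, i), by simpa [hA, h] using fun hij => hs j i hij (add_comm _ _).le,
          add_comm _ _⟩
    · rintro ⟨⟨i, j⟩, hij, rfl⟩
      simp only [hA, Finset.coe_filter, Finset.mem_univ, true_and, Set.mem_ofPred_eq] at hij
      refine ⟨by simp [g], fun a b hab hle => hij.2 ?_⟩
      have heq : Finsupp.single a 1 + Finsupp.single b 1 =
          (Finsupp.single i 1 + Finsupp.single j 1 : Fin 4 →₀ ℕ) := by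
        obtain ⟨c, hc⟩ := exists_add_of_le hle
        have hdeg := congrArg Finsupp.degree hc
        simp only [g, map_add, Finsupp.degree_single] at hdeg
        have : c = 0 := by rw [← Finsupp.degree_eq_zero_iff]; omega
        rw [this, add_zero] at hc
        exact hc.symm
      obtain ⟨ha, hb⟩ := eq_or_eq_of_single_add_single_le hle
      obtain ⟨hi, hj⟩ := eq_or_eq_of_single_add_single_le heq.ge
      rcases ha with rfl | rfl <;> rcases hb with rfl | rfl <;> simp_all
  have hinj : Set.InjOn g A := by
    have hdec : ∀ p q : Fin 4 × Fin 4, p.1 ≤ p.2 → q.1 ≤ q.2 →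
        (∀ l, ((if p.1 = l then 1 else 0) + (if p.2 = l then 1 else 0) : ℕ) =
          (if q.1 = l then 1 else 0) + (if q.2 = l then 1 else 0)) → p = q := by decide
    intro p hp q hq hpq
    simp only [hA, Finset.coe_filter, Finset.mem_univ, true_and, Set.mem_ofPred_eq] at hp hq
    refine hdec p q hp.1 hq.1 fun l => ?_
    simpa [g, Finsupp.single_apply] using DFunLike.congr_fun hpq l
  rw [himage, hinj.ncard_image, Set.ncard_coe_finset]

/-- The degree-2 monomials of the ideal `(y², z², t², xy, xz, xt, zt)`. -/
def targetRel (a b : Fin 4) : Prop :=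
  ¬ ((a = 0 ∧ b = 0) ∨ (a = 1 ∧ (b = 2 ∨ b = 3)) ∨ (b = 1 ∧ (a = 2 ∨ a = 3)))

instance : DecidableRel targetRel := fun _ _ => inferInstanceAs (Decidable (¬ _))

theorem targetRel_comm (a b : Fin 4) : targetRel a b ↔ targetRel b a := by
  revert a b
  decide

set_option synthInstance.maxSize 2000 in
/-- A loop together with two edges avoiding it can be moved to `x², yz, yt`. -/
theorem exists_perm_not_targetRel (i : Fin 4) (p q : Fin 4 × Fin 4) (hpq : p ≠ q)
    (hp : p.1 < p.2 ∧ p.1 ≠ i ∧ p.2 ≠ i) (hq : q.1 < q.2 ∧ q.1 ≠ i ∧ q.2 ≠ i) :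
    ∃ σ : Equiv.Perm (Fin 4), ∀ a b, a ≤ b →
      ((a, b) = (i, i) ∨ (a, b) = p ∨ (a, b) = q ↔ ¬ targetRel (σ a) (σ b)) := by
  have key : ∀ i : Fin 4, ∀ p : Fin 4 × Fin 4, (p.1 < p.2 ∧ p.1 ≠ i ∧ p.2 ≠ i) →
      ∀ q : Fin 4 × Fin 4, (q.1 < q.2 ∧ q.1 ≠ i ∧ q.2 ≠ i) → p ≠ q →
      ∃ c : Fin 4, ∀ a b, a ≤ b → ((a, b) = (i, i) ∨ (a, b) = p ∨ (a, b) = q ↔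
        ¬ targetRel (Equiv.swap 1 c (Equiv.swap 0 i a)) (Equiv.swap 1 c (Equiv.swap 0 i b))) := by
    decide
  obtain ⟨c, hc⟩ := key i p hp q hq hpq
  exact ⟨(Equiv.swap 0 i).trans (Equiv.swap 1 c), hc⟩

theorem exists_perm_targetRel {P : Fin 4 → Fin 4 → Prop} (hP : ∀ i j, P i j → P j i)
    (h2 : (standardExponents (quadraticExponents P) 2).ncard = 3)
    (h3 : (standardExponents (quadraticExponents P) 3).ncard = 1)
    (h5 : (standardExponents (quadraticExponents P) 5).ncard = 1) :
    ∃ σ : Equiv.Perm (Fin 4), ∀ a b, P a b ↔ targetRel (σ a) (σ b) := by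
  classical
  have hloop : ∃ i, ¬ P i i := by
    obtain ⟨d, hd⟩ := Set.ncard_eq_one.mp h5
    obtain ⟨hdeg, hs⟩ := mem_standardExponents_quadratic.mp (hd.ge rfl)
    rw [Finsupp.degree_eq_sum, Fin.sum_univ_four] at hdeg
    have : ∃ i, 2 ≤ d i := by
      by_contra! h
      have := h 0; have := h 1; have := h 2; have := h 3
      omega
    obtain ⟨i, hi⟩ := this
    refine ⟨i, fun hii => hs i i hii ?_⟩
    rw [← Finsupp.single_add, Finsupp.single_le_iff]
    exact hi
  obtain ⟨i, hi⟩ := hloop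
  have huniq : ∀ d ∈ standardExponents (quadraticExponents P) 3, d = Finsupp.single i 3 := by
    obtain ⟨e, he⟩ := Set.ncard_eq_one.mp h3
    intro d hd
    have hi3 := single_mem_standardExponents hi 3
    rw [he] at hd hi3
    exact Eq.trans hd (Eq.symm hi3)
  have hdiag : ∀ j, j ≠ i → P j j := by
    intro j hj
    by_contra h
    have := DFunLike.congr_fun (huniq _ (single_mem_standardExponents h 3)) j
    simp [hj.symm] at this
  have hoff : ∀ j, j ≠ i → P i j := by
    intro j hj
    by_contra h
    have := DFunLike.congr_fun
      (huniq _ (single_add_single_mem_standardExponents hP hj.symm hi h 2)) j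
    simp [hj.symm] at this
  rw [ncard_standardExponents_quadratic_two hP] at h2
  set A := Finset.univ.filter fun p : Fin 4 × Fin 4 => p.1 ≤ p.2 ∧ ¬ P p.1 p.2 with hA
  have hmem : ∀ p : Fin 4 × Fin 4, p ∈ A ↔ p.1 ≤ p.2 ∧ ¬ P p.1 p.2 := by simp [hA]
  have hiA : (i, i) ∈ A := (hmem _).mpr ⟨le_rfl, hi⟩
  have hcard : (A.erase (i, i)).card = 2 := by rw [Finset.card_erase_of_mem hiA, h2]
  obtain ⟨p, q, hpq, hA'⟩ := Finset.card_eq_two.mp hcard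
  have hedge : ∀ r ∈ A.erase (i, i), r.1 < r.2 ∧ r.1 ≠ i ∧ r.2 ≠ i := by
    rintro ⟨a, b⟩ hr
    obtain ⟨hne, hr⟩ := Finset.mem_erase.mp hr
    obtain ⟨hle, hab⟩ := (hmem _).mp hr
    have ha : a ≠ i := by
      rintro rfl
      exact hab (hoff b fun h => hne (by rw [h]))
    have hb : b ≠ i := by
      rintro rfl
      exact hab (hP _ _ (hoff a ha))
    exact ⟨lt_of_le_of_ne hle fun h : a = b => hab (h ▸ hdiag a ha), ha, hb⟩
  have hle : ∀ a b, a ≤ b → (¬ P a b ↔ (a, b) = (i, i) ∨ (a, b) = p ∨ (a, b) = q) := by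
    intro a b hab
    have : (a, b) ∈ A ↔ (a, b) ∈ insert (i, i) (A.erase (i, i)) := by
      rw [Finset.insert_erase hiA]
    rw [hA', hmem] at this
    simpa [hab] using this
  obtain ⟨σ, hσ⟩ := exists_perm_not_targetRel i p q hpq (hedge p (by simp [hA']))
    (hedge q (by simp [hA']))
  refine ⟨σ, fun a b => ?_⟩
  rcases le_total a b with h | h
  · rw [← not_iff_not, hle a b h, hσ a b h]
  · rw [show P a b ↔ P b a from ⟨hP a b, hP b a⟩, targetRel_comm, ← not_iff_not, hle b a h,
      hσ b a h]

theorem stmt9 (k : Type*) [Field k] (J : Ideal (MvPolynomial (Fin 4) k))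
    -- `J` is generated by a set of monomials of degree 2:
    (hmono : ∃ M : Set (MvPolynomial (Fin 4) k),
      (∀ m ∈ M, ∃ i j : Fin 4, m = X i * X j) ∧ J = Ideal.span M)
    (h0 : hilbFn k 4 J 0 = 1) (h1 : hilbFn k 4 J 1 = 4) (h2 : hilbFn k 4 J 2 = 3)
    (h3 : ∀ m, 3 ≤ m → hilbFn k 4 J m = 1) :
    letI x : MvPolynomial (Fin 4) k := X 0
    letI y : MvPolynomial (Fin 4) k := X 1
    letI z : MvPolynomial (Fin 4) k := X 2
    letI t : MvPolynomial (Fin 4) k := X 3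
    ∃ σ : Equiv.Perm (Fin 4),
      Ideal.map (MvPolynomial.rename σ : MvPolynomial (Fin 4) k →ₐ[k] MvPolynomial (Fin 4) k) J =
        Ideal.span {y ^ 2, z ^ 2, t ^ 2, x * y, x * z, x * t, z * t} := by
  obtain ⟨M, hM, rfl⟩ := hmono
  let P : Fin 4 → Fin 4 → Prop := fun i j => (X i * X j : MvPolynomial (Fin 4) k) ∈ Ideal.span M
  have hP : ∀ i j, P i j → P j i := fun i j h => by
    simpa only [P, mul_comm] using h
  have hJ : Ideal.span M = Ideal.span {p | ∃ i j, P i j ∧ p = X i * X j} := by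
    apply le_antisymm
    · refine Ideal.span_le.mpr fun p hp => Ideal.subset_span ?_
      obtain ⟨i, j, rfl⟩ := hM p hp
      exact ⟨i, j, Ideal.subset_span hp, rfl⟩
    · refine Ideal.span_le.mpr ?_
      rintro _ ⟨i, j, h, rfl⟩
      exact h
  have hmon : {p | ∃ i j, P i j ∧ p = X i * X j} =
      (fun e => monomial e (1 : k)) '' quadraticExponents P := by
    ext p
    constructor
    · rintro ⟨i, j, h, rfl⟩
      exact ⟨_, ⟨i, j, h, rfl⟩, by simp [X, monomial_mul]⟩
    · rintro ⟨_, ⟨i, j, h, rfl⟩, rfl⟩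
      exact ⟨i, j, h, by simp [X, monomial_mul]⟩
  have hcard : ∀ m, hilbFn k 4 (Ideal.span M) m =
      (standardExponents (quadraticExponents P) m).ncard := fun m => by
    rw [hJ, hmon, hilbFn_span_monomial]
  obtain ⟨σ, hσ⟩ := exists_perm_targetRel hP ((hcard 2).symm.trans h2)
    ((hcard 3).symm.trans (h3 3 le_rfl)) ((hcard 5).symm.trans (h3 5 (by norm_num)))
  refine ⟨σ, ?_⟩
  rw [hJ, Ideal.map_span]
  congr 1
  ext p
  constructor
  · rintro ⟨_, ⟨i, j, h, rfl⟩, rfl⟩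
    rw [hσ] at h
    rw [map_mul]
    simp only [rename_X]
    generalize σ i = a at h ⊢
    generalize σ j = b at h ⊢
    fin_cases a <;> fin_cases b <;> first
      | exact absurd h (by decide)
      | (simp [pow_two]; done)
      | (refine Set.mem_of_eq_of_mem (mul_comm _ _) ?_; simp [pow_two])
  · intro hp
    have key : ∀ a b, targetRel a b → (X a * X b : MvPolynomial (Fin 4) k) ∈
        (rename σ : MvPolynomial (Fin 4) k →ₐ[k] MvPolynomial (Fin 4) k) ''
          {p | ∃ i j, P i j ∧ p = X i * X j} := fun a b hab =>
      ⟨X (σ.symm a) * X (σ.symm b),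
        ⟨_, _, (hσ _ _).mpr (by simpa using hab), rfl⟩, by simp⟩
    simp only [Set.mem_insert_iff, Set.mem_singleton_iff, pow_two] at hp
    rcases hp with rfl | rfl | rfl | rfl | rfl | rfl | rfl <;> exact key _ _ (by decide)
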